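/- Let G be a finite simple graph with win partition α = {α_1, α_2, ..., α_k}, and let w, w′ ∈ [1/2,1) belong to the same part α_i of the win partition. If C_0 is any configuration of G, (C_0, C_1, C_2, ...) is the sequence of configurations of the w-power index process started from C_0, and (C′_0, C′_1, C′_2, ...) is the sequence of configurations of the w′-power index process started from C′_0 = C_0, then C′_i = C_i for all i > 0. -/

import Mathlib

open scoped Classical

/-- A strategy of a voter: collaborator (`C`) or defector (`D`). -/
inductive Strategy : Type
  | C : Strategy
  | D : Strategy
deriving DecidableEq

noncomputable section

variable {V : Type*}

/-- The closed neighbourhood `N[v]` of a vertex, as a finset. -/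
def closedNbhd (G : SimpleGraph V) [Fintype V] (v : V) : Finset V :=
  Finset.univ.filter fun u => u = v ∨ G.Adj u v

/-- The (Shapley–Shubik style) power of a vertex `v` in configuration `c`
with win condition `w`. -/
def power (G : SimpleGraph V) [Fintype V] (w : ℝ) (c : V → Strategy) (v : V) : ℝ :=
  let N := closedNbhd G v
  let nC := (N.filter fun u => c u = Strategy.C).card
  let nD := (N.filter fun u => c u = Strategy.D).card
  match c v with
  | Strategy.C => if w < (nC : ℝ) / (N.card : ℝ) then 1 / (nC : ℝ) else 0
  | Strategy.D => if (nC : ℝ) / (N.card : ℝ) ≤ w then 1 / (nD : ℝ) else 0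

/-- One step of the `w`-power index process: every vertex adopts the strategy of a
vertex of maximum power in its closed neighbourhood, retaining its own strategy if
vertices of maximum power have differing strategies. -/
def step (G : SimpleGraph V) [Fintype V] (w : ℝ) (c : V → Strategy) (v : V) : Strategy :=
  let N := closedNbhd G v
  let M := N.filter fun u => ∀ x ∈ N, power G w c x ≤ power G w c u
  if ∀ u ∈ M, c u = Strategy.C then Strategy.C
  else if ∀ u ∈ M, c u = Strategy.D then Strategy.D
  else c v

/-- `configSeq G w c0 i` is the configuration `C_i` of the `w`-power index process. -/
def configSeq (G : SimpleGraph V) [Fintype V] (w : ℝ) (c0 : V → Strategy) : ℕ → V → Strategy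
  | 0 => c0
  | k + 1 => step G w (configSeq G w c0 k)

/-- The process is eventually stable. -/
def EventuallyStable (G : SimpleGraph V) [Fintype V] (w : ℝ) (c0 : V → Strategy) : Prop :=
  ∃ i, configSeq G w c0 (i + 1) = configSeq G w c0 i

/-- The process reaches a stable all-collaborator configuration. -/
def CollaboratorDominant (G : SimpleGraph V) [Fintype V] (w : ℝ) (c0 : V → Strategy) : Prop :=
  ∃ i, configSeq G w c0 (i + 1) = configSeq G w c0 i ∧
    ∀ v, configSeq G w c0 i v = Strategy.C

/-- The process reaches a stable all-defector configuration. -/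
def DefectorDominant (G : SimpleGraph V) [Fintype V] (w : ℝ) (c0 : V → Strategy) : Prop :=
  ∃ i, configSeq G w c0 (i + 1) = configSeq G w c0 i ∧
    ∀ v, configSeq G w c0 i v = Strategy.D

/-- The process is eventually periodic with period `ℓ`: `ℓ > 1` is the least integer
such that `C_i = C_{i+ℓ}` for some `i ≥ 0`. -/
def EventuallyPeriodicWithPeriod (G : SimpleGraph V) [Fintype V] (w : ℝ)
    (c0 : V → Strategy) (ℓ : ℕ) : Prop :=
  IsLeast {m : ℕ | 1 < m ∧ ∃ i, configSeq G w c0 (i + m) = configSeq G w c0 i} ℓ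

end

/-- `S_G`: the set of all possible non-zero power values in `G`, namely all numbers
`i/|N[v]|` with `v` a vertex and `i` an integer with `|N[v]|/2 ≤ i ≤ |N[v]|`.
The win partition of `G` is the partition of `[1/2, 1)` into the intervals whose
endpoints are consecutive elements of `S_G` (together with the left endpoint `1/2`). -/
def SG {V : Type*} (G : SimpleGraph V) [Fintype V] : Set ℝ :=
  {s | ∃ (v : V) (i : ℕ), (closedNbhd G v).card ≤ 2 * i ∧ i ≤ (closedNbhd G v).card ∧
    s = (i : ℝ) / ((closedNbhd G v).card : ℝ)}

theorem ratio_le_iff {V : Type} [Fintype V] (G : SimpleGraph V) (w w' : ℝ)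
    (hw : 1 / 2 ≤ w) (hw' : 1 / 2 ≤ w')
    (hsame : ∀ s ∈ SG G, s ≤ w ↔ s ≤ w') (v : V) (n : ℕ)
    (hn : n ≤ (closedNbhd G v).card) :
    (n : ℝ) / ((closedNbhd G v).card : ℝ) ≤ w ↔ (n : ℝ) / ((closedNbhd G v).card : ℝ) ≤ w' := by
  by_cases h : (closedNbhd G v).card ≤ 2 * n
  · exact hsame _ ⟨v, n, h, hn, rfl⟩
  · have hpos : (0 : ℝ) < ((closedNbhd G v).card : ℝ) := by
      have : 0 < (closedNbhd G v).card := by omega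
      exact_mod_cast this
    have h2 : (2 : ℝ) * n < ((closedNbhd G v).card : ℝ) := by
      exact_mod_cast not_le.mp h
    have h3 : (n : ℝ) / ((closedNbhd G v).card : ℝ) ≤ 1 / 2 := by
      rw [div_le_iff₀ hpos]; linarith
    exact ⟨fun _ => h3.trans hw', fun _ => h3.trans hw⟩

theorem power_eq {V : Type} [Fintype V] (G : SimpleGraph V) (w w' : ℝ)
    (hw : 1 / 2 ≤ w) (hw' : 1 / 2 ≤ w')
    (hsame : ∀ s ∈ SG G, s ≤ w ↔ s ≤ w') (c : V → Strategy) :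
    power G w' c = power G w c := by
  funext v
  have key := ratio_le_iff G w w' hw hw' hsame v
    ((closedNbhd G v).filter fun u => c u = Strategy.C).card (Finset.card_filter_le _ _)
  unfold power
  simp only [← not_le, key]

/-- If `w, w' ∈ [1/2, 1)` lie in the same part of the win partition
of `G` (equivalently, every element of `S_G` lies below `w` iff it lies below `w'`),
then the `w`- and `w'`-power index processes started from the same initial
configuration agree at every time `i > 0`. -/
theorem statement4 {V : Type} [Fintype V] (G : SimpleGraph V) (w w' : ℝ)
    (hw : 1 / 2 ≤ w ∧ w < 1) (hw' : 1 / 2 ≤ w' ∧ w' < 1)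
    (hsame : ∀ s ∈ SG G, s ≤ w ↔ s ≤ w')
    (c0 : V → Strategy) :
    ∀ i : ℕ, 0 < i → configSeq G w' c0 i = configSeq G w c0 i := by
  intro i _
  induction i with
  | zero => rfl
  | succ k ih =>
    have ih' : configSeq G w' c0 k = configSeq G w c0 k := by
      rcases Nat.eq_zero_or_pos k with h | h
      · subst h; rfl
      · exact ih h
    funext v
    simp only [configSeq, step, ih', power_eq G w w' hw.1 hw'.1 hsame]
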